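/- arXiv:2003.08265 — 2 statements merged into one kernel-verified Lean document; each statement's English description precedes it below -/
import Mathlib

section
/- Let M be a rigid representation (Ext¹_Q(M,M)=0) of a finite acyclic quiver Q with dimension vector d, and e a dimension vector with non-empty quiver Grassmannian Gr_e(M). Then at every point N ∈ Gr_e(M), the tangent space Hom_Q(N, M/N) has dimension ⟨e, d−e⟩; hence Gr_e(M) is smooth of dimension ⟨e, d−e⟩. -/
open Module

/-- A finite quiver: finite sets of vertices and arrows, with source and target maps. -/
structure FinQuiver where
  V : Type
  A : Type
  [fV : Fintype V]
  [fA : Fintype A]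
  s : A → V
  t : A → V

attribute [instance] FinQuiver.fV FinQuiver.fA

/-- A finite-dimensional complex representation of a finite quiver. -/
structure QRep (Q : FinQuiver) where
  space : Q.V → Type
  [inst_add : ∀ i, AddCommGroup (space i)]
  [inst_mod : ∀ i, Module ℂ (space i)]
  [inst_fd : ∀ i, FiniteDimensional ℂ (space i)]
  map : ∀ a : Q.A, space (Q.s a) →ₗ[ℂ] space (Q.t a)

attribute [instance] QRep.inst_add QRep.inst_mod QRep.inst_fd

variable {Q : FinQuiver}

/-- Degree-zero morphism space `Hom(e,d)`. -/
abbrev Hom0 (N M : QRep Q) := ∀ i, N.space i →ₗ[ℂ] M.space i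

/-- Degree-one morphism space `Hom(e,d[1])`. -/
abbrev Hom1 (N M : QRep Q) := ∀ a : Q.A, N.space (Q.s a) →ₗ[ℂ] M.space (Q.t a)

/-- The map `Φ^M_N : (f_i) ↦ (M_α ∘ f_{s α} − f_{t α} ∘ N_α)`. -/
def Phi (N M : QRep Q) : Hom0 N M →ₗ[ℂ] Hom1 N M where
  toFun f := fun a => (M.map a).comp (f (Q.s a)) - (f (Q.t a)).comp (N.map a)
  map_add' f g := by
    funext a; ext x; simp [LinearMap.add_comp, LinearMap.comp_add]; abel
  map_smul' c f := by
    funext a; ext x; simp [smul_sub]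

/-- `Hom_Q(N,M)` realized as the kernel of `Φ`. -/
abbrev HomQ (N M : QRep Q) : Submodule ℂ (Hom0 N M) := LinearMap.ker (Phi N M)

/-- `Ext¹_Q(N,M)` realized as the cokernel of `Φ` (valid since `Rep Q` is hereditary). -/
abbrev ExtQ (N M : QRep Q) := Hom1 N M ⧸ LinearMap.range (Phi N M)

/-- Morphisms of quiver representations. -/
abbrev QHomT (N M : QRep Q) :=
  {f : ∀ i, N.space i →ₗ[ℂ] M.space i //
    ∀ a : Q.A, (M.map a).comp (f (Q.s a)) = (f (Q.t a)).comp (N.map a)}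

/-- A subrepresentation: a family of subspaces stable under the structure maps. -/
structure SubRep (M : QRep Q) where
  carrier : ∀ i, Submodule ℂ (M.space i)
  stable : ∀ a : Q.A, ∀ x ∈ carrier (Q.s a), M.map a x ∈ carrier (Q.t a)

/-- A subrepresentation as a representation. -/
def SubRep.toRep {M : QRep Q} (N : SubRep M) : QRep Q where
  space i := N.carrier i
  map a := (M.map a).restrict (N.stable a)

/-- The quotient representation `M/N`. -/
def SubRep.quot {M : QRep Q} (N : SubRep M) : QRep Q where
  space i := M.space i ⧸ N.carrier i
  map a := Submodule.mapQ (N.carrier (Q.s a)) (N.carrier (Q.t a)) (M.map a)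
    (fun x hx => N.stable a x hx)

/-- A linear map from a subspace of `V` to a quotient of `W` is induced by a linear map
`V → W`. -/
theorem exists_mkQ_comp_subtype_eq {K V W : Type*} [Field K] [AddCommGroup V] [Module K V]
    [AddCommGroup W] [Module K W] (p : Submodule K V) (q : Submodule K W) (g : p →ₗ[K] W ⧸ q) :
    ∃ h : V →ₗ[K] W, q.mkQ ∘ₗ h ∘ₗ p.subtype = g := by
  obtain ⟨g', hg'⟩ := LinearMap.exists_extend g
  obtain ⟨h, hh⟩ := Module.projective_lifting_property q.mkQ g' q.mkQ_surjective
  exact ⟨h, by rw [← LinearMap.comp_assoc, hh, hg']⟩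

/-- Over a quiver, `Ext¹(M, M) = 0` forces `Ext¹(N, M/N) = 0` for every subrepresentation `N` of
`M`. -/
theorem Phi_toRep_quot_surjective {M : QRep Q} (hM : Function.Surjective (Phi M M))
    (N : SubRep M) : Function.Surjective (Phi N.toRep N.quot) := by
  intro g
  choose h hh using fun a : Q.A =>
    exists_mkQ_comp_subtype_eq (N.carrier (Q.s a)) (N.carrier (Q.t a)) (g a)
  obtain ⟨f, hf⟩ := hM h
  refine ⟨fun i => (N.carrier i).mkQ ∘ₗ f i ∘ₗ (N.carrier i).subtype, ?_⟩
  funext a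
  refine Eq.trans ?_ (hh a)
  rw [← hf]
  rfl

/-- When `Ext¹(N, M) = 0`, the dimension of `Hom(N, M)` is the Euler form of the dimension
vectors. -/
theorem finrank_HomQ_of_surjective (N M : QRep Q) (h : Function.Surjective (Phi N M)) :
    (finrank ℂ (HomQ N M) : ℤ) =
      (∑ i : Q.V, (finrank ℂ (N.space i) : ℤ) * finrank ℂ (M.space i)) -
        ∑ a : Q.A, (finrank ℂ (N.space (Q.s a)) : ℤ) * finrank ℂ (M.space (Q.t a)) := by
  have rank_nullity := (Phi N M).finrank_range_add_finrank_ker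
  rw [LinearMap.range_eq_top.2 h, finrank_top, Module.finrank_pi_fintype,
    Module.finrank_pi_fintype] at rank_nullity
  simp only [Module.finrank_linearMap] at rank_nullity
  zify at rank_nullity
  linarith

/-- for a rigid representation `M` of dimension vector `d`, at every
point `N` of `Gr_e(M)` the tangent space `Hom_Q(N, M/N)` has dimension `⟨e, d−e⟩`. -/
theorem tangent_dim_rigid (Q : FinQuiver) (M : QRep Q) (d e : Q.V → ℕ)
    (hd : ∀ i, Module.finrank ℂ (M.space i) = d i)
    (hrigid : Subsingleton (ExtQ M M))
    (N : SubRep M) (he : ∀ i, Module.finrank ℂ (N.carrier i) = e i) :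
    (Module.finrank ℂ (HomQ N.toRep N.quot) : ℤ) =
      (∑ i : Q.V, (e i : ℤ) * ((d i : ℤ) - (e i : ℤ))) -
        ∑ a : Q.A, (e (Q.s a) : ℤ) * ((d (Q.t a) : ℤ) - (e (Q.t a) : ℤ)) := by
  have hM : Function.Surjective (Phi M M) :=
    LinearMap.range_eq_top.1 (Submodule.Quotient.subsingleton_iff.1 hrigid)
  have hquot : ∀ i, (finrank ℂ (N.quot.space i) : ℤ) = (d i : ℤ) - (e i : ℤ) := by
    intro i
    have h := (N.carrier i).finrank_quotient_add_finrank
    rw [he, hd] at h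
    change (finrank ℂ (M.space i ⧸ N.carrier i) : ℤ) = _
    omega
  have hsub : ∀ i, finrank ℂ (N.toRep.space i) = e i := he
  rw [finrank_HomQ_of_surjective _ _ (Phi_toRep_quot_surjective hM N)]
  simp only [hquot, hsub]
end

section
/- Let ξ ∈ Ext¹_Q(S, X) be a non-split generating extension (i.e. Ext¹_Q(S,X) = ℂ·ξ is one-dimensional). If N₁ ⊆ X and N₂ ⊆ X are subrepresentations with dim Ext¹_Q(S, X/N₁) = 1 and dim Ext¹_Q(S, X/N₂) = 1, then dim Ext¹_Q(S, X/(N₁+N₂)) = 1. -/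
open Module

variable {Q : FinQuiver}

/-- The quotient map `M → M/N` at a vertex. -/
def SubRep.proj {M : QRep Q} (N : SubRep M) (i : Q.V) : M.space i →ₗ[ℂ] N.quot.space i :=
  (N.carrier i).mkQ

theorem SubRep.proj_surjective {M : QRep Q} (N : SubRep M) (i : Q.V) :
    Function.Surjective (N.proj i) :=
  (N.carrier i).mkQ_surjective

theorem SubRep.proj_eq_zero_iff {M : QRep Q} (N : SubRep M) (i : Q.V) (x : M.space i) :
    N.proj i x = 0 ↔ x ∈ N.carrier i :=
  Submodule.Quotient.mk_eq_zero _

/-- The map `Hom(S,M[1]) → Hom(S,(M/N)[1])` induced by the quotient map. -/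
def SubRep.projHom1 (S : QRep Q) {M : QRep Q} (N : SubRep M) : Hom1 S M →ₗ[ℂ] Hom1 S N.quot where
  toFun h a := (N.proj (Q.t a)).comp (h a)
  map_add' f g := by
    funext a; exact LinearMap.comp_add _ _ _
  map_smul' c f := by
    funext a; exact LinearMap.comp_smul _ _ _

theorem SubRep.projHom1_surjective (S : QRep Q) {M : QRep Q} (N : SubRep M) :
    Function.Surjective (N.projHom1 S) := by
  intro h
  choose g hg using fun a =>
    Module.projective_lifting_property (N.proj (Q.t a)) (h a) (N.proj_surjective _)
  exact ⟨g, funext hg⟩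

theorem SubRep.mem_ker_projHom1 (S : QRep Q) {M : QRep Q} (N : SubRep M) (h : Hom1 S M) :
    h ∈ LinearMap.ker (N.projHom1 S) ↔ ∀ a x, h a x ∈ N.carrier (Q.t a) := by
  simp only [← N.proj_eq_zero_iff, LinearMap.mem_ker, funext_iff, LinearMap.ext_iff]
  rfl

theorem SubRep.phi_proj_comp (S : QRep Q) {M : QRep Q} (N : SubRep M) (f : Hom0 S M) :
    Phi S N.quot (fun i => (N.proj i).comp (f i)) = N.projHom1 S (Phi S M f) := by
  funext a
  ext x
  exact (map_sub (N.proj (Q.t a)) _ _).symm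

theorem SubRep.range_phi_quot (S : QRep Q) {M : QRep Q} (N : SubRep M) :
    LinearMap.range (Phi S N.quot) = (LinearMap.range (Phi S M)).map (N.projHom1 S) := by
  apply le_antisymm
  · rintro _ ⟨f, rfl⟩
    choose g hg using fun i =>
      Module.projective_lifting_property (N.proj i) (f i) (N.proj_surjective i)
    obtain rfl : (fun i => (N.proj i).comp (g i)) = f := funext hg
    exact ⟨_, ⟨g, rfl⟩, (N.phi_proj_comp S g).symm⟩
  · rintro _ ⟨_, ⟨f, rfl⟩, rfl⟩
    exact ⟨_, N.phi_proj_comp S f⟩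

/-- `Ext¹(S,M/N)` has the dimension of the quotient of `Hom(S,M[1])` by the coboundaries together
with the elements taking values in `N`. -/
theorem SubRep.finrank_extQ_quot (S : QRep Q) {M : QRep Q} (N : SubRep M) :
    finrank ℂ (ExtQ S N.quot) =
      finrank ℂ (Hom1 S M ⧸ (LinearMap.range (Phi S M) ⊔ LinearMap.ker (N.projHom1 S))) := by
  have hker : LinearMap.ker ((LinearMap.range (Phi S N.quot)).mkQ ∘ₗ N.projHom1 S) =
      LinearMap.range (Phi S M) ⊔ LinearMap.ker (N.projHom1 S) := by
    rw [LinearMap.ker_comp, Submodule.ker_mkQ, N.range_phi_quot, Submodule.comap_map_eq]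
  have hsurj : Function.Surjective
      ((LinearMap.range (Phi S N.quot)).mkQ ∘ₗ N.projHom1 S) := by
    rw [LinearMap.coe_comp]
    exact (Submodule.mkQ_surjective _).comp (N.projHom1_surjective S)
  rw [← hker]
  exact (LinearMap.quotKerEquivOfSurjective _ hsurj).finrank_eq.symm

/-- The dimensions of `Ext¹(S,M/N)` and `Ext¹(S,M)` agree exactly when every element of
`Hom(S,M[1])` with values in `N` is a coboundary. -/
theorem SubRep.finrank_extQ_quot_eq_iff (S : QRep Q) {M : QRep Q} (N : SubRep M) :
    finrank ℂ (ExtQ S N.quot) = finrank ℂ (ExtQ S M) ↔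
      LinearMap.ker (N.projHom1 S) ≤ LinearMap.range (Phi S M) := by
  rw [N.finrank_extQ_quot]
  constructor
  · intro h
    have h₁ := Submodule.finrank_quotient_add_finrank (LinearMap.range (Phi S M))
    have h₂ := Submodule.finrank_quotient_add_finrank
      (LinearMap.range (Phi S M) ⊔ LinearMap.ker (N.projHom1 S))
    have heq := Submodule.eq_of_le_of_finrank_eq
      (le_sup_left : LinearMap.range (Phi S M) ≤ _ ⊔ LinearMap.ker (N.projHom1 S)) 
      (Nat.add_left_cancel ((congrArg (· + _) h).trans (h₁.trans h₂.symm)))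
    exact le_sup_right.trans heq.ge
  · intro h
    rw [sup_eq_left.mpr h]

theorem SubRep.ker_projHom1_le_sup (S : QRep Q) {M : QRep Q} {N₁ N₂ N₃ : SubRep M}
    (hN₃ : ∀ i, N₃.carrier i = N₁.carrier i ⊔ N₂.carrier i) :
    LinearMap.ker (N₃.projHom1 S) ≤
      LinearMap.ker (N₁.projHom1 S) ⊔ LinearMap.ker (N₂.projHom1 S) := by
  intro h hh
  rw [N₃.mem_ker_projHom1] at hh
  have hsplit : ∀ a, ∃ g : S.space (Q.s a) →ₗ[ℂ] M.space (Q.t a),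
      ∀ x, g x ∈ N₁.carrier (Q.t a) ∧ h a x - g x ∈ N₂.carrier (Q.t a) := by
    intro a
    let A := N₁.carrier (Q.t a)
    let B := N₂.carrier (Q.t a)
    have hle : LinearMap.range (h a) ≤ LinearMap.range (A.subtype.coprod B.subtype) := by
      rintro _ ⟨x, rfl⟩
      rw [LinearMap.range_coprod, Submodule.range_subtype, Submodule.range_subtype, ← hN₃]
      exact hh a x
    obtain ⟨k, hk⟩ := Module.projective_lifting_property
      (A.subtype.coprod B.subtype).rangeRestrict
      ((h a).codRestrict _ fun x => hle ⟨x, rfl⟩) (LinearMap.surjective_rangeRestrict _)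
    refine ⟨A.subtype ∘ₗ LinearMap.fst ℂ A B ∘ₗ k, fun x => ⟨(k x).1.2, ?_⟩⟩
    have hx : ((k x).1 : M.space (Q.t a)) + (k x).2 = h a x :=
      congrArg Subtype.val (LinearMap.congr_fun hk x)
    rw [← hx]
    simp [B]
  choose g hg using hsplit
  rw [← add_sub_cancel (show Hom1 S M from g) h]
  exact Submodule.add_mem_sup ((N₁.mem_ker_projHom1 S _).mpr fun a x => (hg a x).1)
    ((N₂.mem_ker_projHom1 S _).mpr fun a x => (hg a x).2)

/-- if `Ext¹_Q(S,X)` is one-dimensional (spanned by a non-split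
generating extension) and `N₁, N₂ ⊆ X` satisfy `dim Ext¹_Q(S, X/N₁) = 1` and
`dim Ext¹_Q(S, X/N₂) = 1`, then `dim Ext¹_Q(S, X/(N₁+N₂)) = 1`. -/
theorem generating_extension_sum (Q : FinQuiver) (S X : QRep Q)
    (hgen : Module.finrank ℂ (ExtQ S X) = 1)
    (N₁ N₂ N₃ : SubRep X)
    (hN₃ : ∀ i, N₃.carrier i = N₁.carrier i ⊔ N₂.carrier i)
    (h1 : Module.finrank ℂ (ExtQ S N₁.quot) = 1)
    (h2 : Module.finrank ℂ (ExtQ S N₂.quot) = 1) :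
    Module.finrank ℂ (ExtQ S N₃.quot) = 1 := by
  rw [← hgen] at h1 h2 ⊢
  rw [SubRep.finrank_extQ_quot_eq_iff] at h1 h2 ⊢
  exact (SubRep.ker_projHom1_le_sup S hN₃).trans (sup_le h1 h2)
end
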